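/- Let G be a *-antimonotone game over a poset A. Then G has parity (G is even or odd). -/

import Mathlib

/-- Games over a poset `α`: atomic games `[a]` for `a : α`, and composite games
`⟨L|R⟩` given by nonempty families of left and right options. -/
inductive Game (α : Type) : Type 1 where
  | atom : α → Game α
  | comp : (ι κ : Type) → (ι → Game α) → (κ → Game α) → Nonempty ι → Nonempty κ → Game α

namespace Game

variable {α β : Type}

/-- `G'` is a left option of the game. -/
def IsLeftOption (G' : Game α) : Game α → Prop
  | atom _ => False
  | comp _ _ L _ _ _ => ∃ i, L i = G'

/-- `G'` is a right option of the game. -/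
def IsRightOption (G' : Game α) : Game α → Prop
  | atom _ => False
  | comp _ _ _ R _ _ => ∃ k, R k = G'

/-- `G'` is an option of `G`. -/
def IsOption (G' G : Game α) : Prop := IsLeftOption G' G ∨ IsRightOption G' G

/-- A game is composite if it is not atomic. -/
def IsComposite : Game α → Prop
  | atom _ => False
  | comp _ _ _ _ _ _ => True

/-- `G'` is a follower of `G`: `G` itself, an option of `G`, or recursively a follower
of an option of `G`. -/
def IsFollower (G' G : Game α) : Prop := Relation.ReflTransGen IsOption G' G

/-- The dual game: Left and Right switch sides; it is a game over the opposite poset. -/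
def dual : Game α → Game αᵒᵈ
  | atom a => atom (OrderDual.toDual a)
  | comp ι κ L R hι hκ => comp κ ι (fun k => (R k).dual) (fun i => (L i).dual) hκ hι

/-- The image of a game under a (monotone) function applied to atoms. -/
def map (f : α → β) : Game α → Game β
  | atom a => atom (f a)
  | comp ι κ L R hι hκ => comp ι κ (fun i => (L i).map f) (fun k => (R k).map f) hι hκ

/-- The (disjunctive) sum of a game over `α` and a game over `β`, a game over `α × β`. -/
noncomputable def add : Game α → Game β → Game (α × β) := by
  intro G
  induction G with
  | atom g =>
    intro H
    induction H with
    | atom h => exact atom (g, h)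
    | comp ι κ L R hι hκ IHL IHR => exact comp ι κ IHL IHR hι hκ
  | comp ι κ L R hι hκ IHL IHR =>
    intro H
    induction H with
    | atom h => exact comp ι κ (fun i => IHL i (atom h)) (fun k => IHR k (atom h)) hι hκ
    | comp ι' κ' L' R' hι' hκ' IHL' IHR' =>
      exact comp (ι ⊕ ι') (κ ⊕ κ')
        (Sum.elim (fun i => IHL i (comp ι' κ' L' R' hι' hκ')) IHL')
        (Sum.elim (fun k => IHR k (comp ι' κ' L' R' hι' hκ')) IHR')
        (hι.elim fun i => ⟨Sum.inl i⟩) (hκ.elim fun k => ⟨Sum.inl k⟩)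

mutual
/-- Left has a first player winning strategy in a game over the boolean poset:
either the game is the atom `⊤`, or some left option has a second player
winning strategy for Left. -/
inductive LeftWinsFirst : Game Bool → Prop where
  | atom_top : LeftWinsFirst (atom true)
  | move {G G' : Game Bool} : IsLeftOption G' G → LeftWinsSecond G' → LeftWinsFirst G

/-- Left has a second player winning strategy in a game over the boolean poset:
every right option has a first player winning strategy for Left, and if the game
is atomic it is the atom `⊤`. -/
inductive LeftWinsSecond : Game Bool → Prop where
  | mk {G : Game Bool} : (∀ G', IsRightOption G' G → LeftWinsFirst G') →
      (∀ b, G = atom b → b = true) → LeftWinsSecond G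
end

mutual
/-- A game is even if all of its options are odd (atomic games are even). -/
inductive Even {α : Type} : Game α → Prop where
  | mk {G : Game α} : (∀ G', IsOption G' G → Odd G') → Even G

/-- A game is odd if it is composite and all of its options are even. -/
inductive Odd {α : Type} : Game α → Prop where
  | mk {G : Game α} : G.IsComposite → (∀ G', IsOption G' G → Even G') → Odd G
end

/-- A game has parity if it is even or odd. -/
def HasParity (G : Game α) : Prop := Even G ∨ Odd G

/-- `G` and `H` have matching parity (both even or both odd). -/
def MatchingParity (G H : Game α) : Prop := (Even G ∧ Even H) ∨ (Odd G ∧ Odd H)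

/-- `G` and `H` have mismatching parity (one even, the other odd). -/
def MismatchParity (G H : Game α) : Prop := (Even G ∧ Odd H) ∨ (Odd G ∧ Even H)

mutual
/-- The intrinsic order `G ≤ H` on games over a poset: every left option `G^L` of `G`
satisfies `G^L ◁ H`, every right option `H^R` of `H` satisfies `G ◁ H^R`, and if
both games are atoms `[g]`, `[h]` then `g ≤ h`. -/
inductive Le {α : Type} [PartialOrder α] : Game α → Game α → Prop where
  | mk {G H : Game α} :
      (∀ G', IsLeftOption G' G → Tri G' H) →
      (∀ H', IsRightOption H' H → Tri G H') →
      (∀ g h, G = atom g → H = atom h → g ≤ h) →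
      Le G H

/-- The intrinsic relation `G ◁ H` on games over a poset: some right option `G^R` of `G`
satisfies `G^R ≤ H`, or some left option `H^L` of `H` satisfies `G ≤ H^L`. -/
inductive Tri {α : Type} [PartialOrder α] : Game α → Game α → Prop where
  | inr {G H G' : Game α} : IsRightOption G' G → Le G' H → Tri G H
  | inl {G H H' : Game α} : IsLeftOption H' H → Le G H' → Tri G H
end

/-- The comparison game `λ(Gᵒᵖ + H)`, a game over the boolean poset, where
`λ : αᵒᵈ × α → 𝔹` is the monotone map with `λ(xᵒᵖ, y) = ⊤` iff `x ≤ y`. -/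
noncomputable def comparison [PartialOrder α] (G H : Game α) : Game Bool :=
  map (fun p : αᵒᵈ × α => @decide (OrderDual.ofDual p.1 ≤ p.2) (Classical.propDecidable _))
    (G.dual.add H)

/-- A game is locally premotive if Left has a first player winning strategy in
the comparison game `λ(Gᵒᵖ + G)`. -/
def LocallyPremotive [PartialOrder α] (G : Game α) : Prop := LeftWinsFirst (comparison G G)

/-- A game is premotive if it and all of its followers are locally premotive. -/
def Premotive [PartialOrder α] (G : Game α) : Prop :=
  ∀ G', IsFollower G' G → LocallyPremotive G'

/-- The game `* = ⟨0|0⟩` over the one-element poset. -/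
def star : Game Unit := comp Unit Unit (fun _ => atom ()) (fun _ => atom ()) ⟨()⟩ ⟨()⟩

/-- `G + *`, identified with a game over `α` via the isomorphism `α × 1 ≅ α`. -/
noncomputable def addStar (G : Game α) : Game α := map Prod.fst (G.add star)

/-- A game is locally `*`-antimonotone if `G^L + * ≤ G ≤ G^R + *` for all left and
right options `G^L`, `G^R`. -/
def LocallyStarAnti [PartialOrder α] (G : Game α) : Prop :=
  (∀ G', IsLeftOption G' G → Le G'.addStar G) ∧ (∀ G', IsRightOption G' G → Le G G'.addStar)

/-- A game is `*`-antimonotone if it and all of its followers are locally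
`*`-antimonotone. -/
def StarAnti [PartialOrder α] (G : Game α) : Prop :=
  ∀ G', IsFollower G' G → LocallyStarAnti G'

/-- `ε(G + X)`: the game `G` over `α` embedded in a context `X`, a game over the poset
`[α, 𝔹]` of monotone functions `α → 𝔹`, via the application map `ε(a, f) = f a`. -/
noncomputable def ctxSum [PartialOrder α] (G : Game α) (X : Game (α →o Bool)) : Game Bool :=
  map (fun p : α × (α →o Bool) => p.2 p.1) (G.add X)

/-- The outcome `(o_L(G), o_R(G)) ∈ 𝔹 × 𝔹` of a game over the boolean poset:
`o_L(G) = ⊤` iff Left has a first player winning strategy and `o_R(G) = ⊤` iff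
Left has a second player winning strategy. -/
noncomputable def outcome (G : Game Bool) : Bool × Bool :=
  (@decide (LeftWinsFirst G) (Classical.propDecidable _),
   @decide (LeftWinsSecond G) (Classical.propDecidable _))

/-- The contextual order `G ≤_c H`: `o(G+X) ≤ o(H+X)` for every context `X`. -/
def ContextualLe [PartialOrder α] (G H : Game α) : Prop :=
  ∀ X : Game (α →o Bool), outcome (ctxSum G X) ≤ outcome (ctxSum H X)

/-- The contextual relation `G ◁_c H`: `o_R(G+X) ≤ o_L(H+X)` for every context `X`. -/
def ContextualTri [PartialOrder α] (G H : Game α) : Prop :=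
  ∀ X : Game (α →o Bool), (outcome (ctxSum G X)).2 ≤ (outcome (ctxSum H X)).1

/-- Two games are identical when they are equal as set-based games: both are the same
atom, or both are composite with identical sets of left options and identical sets of
right options (recursively). -/
def Identical : Game α → Game α → Prop
  | atom a, atom b => a = b
  | comp _ _ L R _ _, comp _ _ L' R' _ _ =>
      ((∀ i, ∃ i', Identical (L i) (L' i')) ∧ (∀ i', ∃ i, Identical (L i) (L' i'))) ∧
      ((∀ k, ∃ k', Identical (R k) (R' k')) ∧ (∀ k', ∃ k, Identical (R k) (R' k')))
  | _, _ => False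

theorem Even.opt {G G' : Game α} (h : Even G) (o : IsOption G' G) : Odd G' := by
  cases h with
  | mk h => exact h _ o

theorem Odd.opt {G G' : Game α} (h : Odd G) (o : IsOption G' G) : Even G' := by
  cases h with
  | mk _ h => exact h _ o

theorem Odd.left {G : Game α} (h : Odd G) : ∃ G', IsLeftOption G' G := by
  cases h with
  | mk c _ =>
    cases G with
    | atom a => exact c.elim
    | comp ι κ L R hι hκ => exact ⟨_, hι.some, rfl⟩

theorem Odd.right {G : Game α} (h : Odd G) : ∃ G', IsRightOption G' G := by
  cases h with
  | mk c _ =>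
    cases G with
    | atom a => exact c.elim
    | comp ι κ L R hι hκ => exact ⟨_, hκ.some, rfl⟩

theorem MismatchParity.left {G G' K : Game α} (h : MismatchParity G K) (o : IsOption G' G) :
    MatchingParity G' K := by
  rcases h with ⟨a, b⟩ | ⟨a, b⟩
  · exact Or.inr ⟨a.opt o, b⟩
  · exact Or.inl ⟨a.opt o, b⟩

theorem MismatchParity.right {G K K' : Game α} (h : MismatchParity G K) (o : IsOption K' K) :
    MatchingParity G K' := by
  rcases h with ⟨a, b⟩ | ⟨a, b⟩
  · exact Or.inl ⟨a, b.opt o⟩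
  · exact Or.inr ⟨a, b.opt o⟩

theorem MatchingParity.left {G G' K : Game α} (h : MatchingParity G K) (o : IsOption G' G) :
    MismatchParity G' K := by
  rcases h with ⟨a, b⟩ | ⟨a, b⟩
  · exact Or.inr ⟨a.opt o, b⟩
  · exact Or.inl ⟨a.opt o, b⟩

theorem MatchingParity.right {G K K' : Game α} (h : MatchingParity G K) (o : IsOption K' K) :
    MismatchParity G K' := by
  rcases h with ⟨a, b⟩ | ⟨a, b⟩
  · exact Or.inl ⟨a, b.opt o⟩
  · exact Or.inr ⟨a, b.opt o⟩

theorem opt_induction {P : Game α → Prop} (h : ∀ G, (∀ G', IsOption G' G → P G') → P G)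
    (G : Game α) : P G := by
  induction G with
  | atom a => exact h _ (by rintro G' (o | o) <;> exact o.elim)
  | comp ι κ L R hι hκ ihL ihR =>
    apply h
    rintro G' (⟨i, rfl⟩ | ⟨k, rfl⟩)
    · exact ihL i
    · exact ihR k

theorem Le.l [PartialOrder α] {G H G' : Game α} (h : Le G H) (o : IsLeftOption G' G) :
    Tri G' H := by
  cases h with
  | mk a _ _ => exact a _ o

theorem Le.r [PartialOrder α] {G H H' : Game α} (h : Le G H) (o : IsRightOption H' H) :
    Tri G H' := by
  cases h with
  | mk _ a _ => exact a _ o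

theorem Tri.split [PartialOrder α] {G H : Game α} (h : Tri G H) :
    (∃ G', IsRightOption G' G ∧ Le G' H) ∨ (∃ H', IsLeftOption H' H ∧ Le G H') := by
  cases h with
  | inr a b => exact Or.inl ⟨_, a, b⟩
  | inl a b => exact Or.inr ⟨_, a, b⟩

/-- No game lies between two games of mismatching parity (and variants). -/
def NoBetween [PartialOrder α] (G H K : Game α) : Prop :=
  (MismatchParity G K → Le G H → Le H K → False) ∧
  (MatchingParity G K → Tri G H → Le H K → False) ∧
  (MatchingParity G K → Le G H → Tri H K → False)

theorem noBetween_step [PartialOrder α] (G H K : Game α)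
    (hG : ∀ G', IsOption G' G → NoBetween G' H K)
    (hH : ∀ H', IsOption H' H → NoBetween G H' K)
    (hK : ∀ K', IsOption K' K → NoBetween G H K') : NoBetween G H K := by
  refine ⟨fun m a b => ?_, fun m a b => ?_, fun m a b => ?_⟩
  · rcases id m with ⟨_, o⟩ | ⟨o, _⟩
    · obtain ⟨K', hK'⟩ := o.right
      exact (hK K' (Or.inr hK')).2.2 (m.right (Or.inr hK')) a (b.r hK')
    · obtain ⟨G', hG'⟩ := o.left
      exact (hG G' (Or.inl hG')).2.1 (m.left (Or.inl hG')) (a.l hG') b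
  · rcases a.split with ⟨G', o, c⟩ | ⟨H', o, c⟩
    · exact (hG G' (Or.inr o)).1 (m.left (Or.inr o)) c b
    · exact (hH H' (Or.inl o)).2.2 m c (b.l o)
  · rcases b.split with ⟨H', o, c⟩ | ⟨K', o, c⟩
    · exact (hH H' (Or.inr o)).2.1 m (a.r o) c
    · exact (hK K' (Or.inl o)).1 (m.right (Or.inl o)) a c

theorem noBetween [PartialOrder α] (G H K : Game α) : NoBetween G H K := by
  revert H K
  refine opt_induction (P := fun G => ∀ H K, NoBetween G H K) ?_ G
  intro G hG H
  refine opt_induction (P := fun H => ∀ K, NoBetween G H K) ?_ H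
  intro H hH K
  refine opt_induction (P := fun K => NoBetween G H K) ?_ K
  intro K hK
  exact noBetween_step G H K (fun G' o => hG G' o H K) (fun H' o => hH H' o K) hK

theorem map_add_unit (G : Game α) : map Prod.fst (G.add (atom ())) = G := by
  induction G with
  | atom a => rfl
  | comp ι κ L R hι hκ ihL ihR =>
    change comp ι κ (fun i => map Prod.fst ((L i).add (atom ())))
      (fun k => map Prod.fst ((R k).add (atom ()))) hι hκ = _
    simp only [ihL, ihR]

theorem addStar_composite (G : Game α) : IsComposite G.addStar := by
  cases G <;> trivial

theorem addStar_opt (G X : Game α) (o : IsOption X G.addStar) :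
    X = G ∨ ∃ G', IsOption G' G ∧ X = G'.addStar := by
  cases G with
  | atom a =>
    left
    rcases o with ⟨i, rfl⟩ | ⟨i, rfl⟩ <;> rfl
  | comp ι κ L R hι hκ =>
    rcases o with ⟨i | i, rfl⟩ | ⟨i | i, rfl⟩
    · exact Or.inr ⟨L i, Or.inl ⟨i, rfl⟩, rfl⟩
    · exact Or.inl (map_add_unit (comp ι κ L R hι hκ))
    · exact Or.inr ⟨R i, Or.inr ⟨i, rfl⟩, rfl⟩
    · exact Or.inl (map_add_unit (comp ι κ L R hι hκ))

theorem addStar_parity (G : Game α) :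
    (Even G → Odd G.addStar) ∧ (Odd G → Even G.addStar) := by
  refine opt_induction (P := fun G : Game α =>
    (Even G → Odd G.addStar) ∧ (Odd G → Even G.addStar)) ?_ G
  intro G ih
  refine ⟨fun e => Odd.mk (addStar_composite G) ?_, fun e => Even.mk ?_⟩ <;> intro X o <;>
    rcases addStar_opt G X o with rfl | ⟨G', o', rfl⟩
  · exact e
  · exact (ih G' o').2 (e.opt o')
  · exact e
  · exact (ih G' o').1 (e.opt o')

/-- Every `*`-antimonotone game has parity. -/
theorem starAnti_hasParity {α : Type} [PartialOrder α] (G : Game α) (h : StarAnti G) :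
    HasParity G := by
  induction G with
  | atom a => exact Or.inl (Even.mk (by rintro G' (o | o) <;> exact o.elim))
  | comp ι κ L R hι hκ ihL ihR =>
    have pL : ∀ i, HasParity (L i) := fun i => ihL i fun G' f =>
      h G' (Relation.ReflTransGen.tail f (Or.inl ⟨i, rfl⟩))
    have pR : ∀ k, HasParity (R k) := fun k => ihR k fun G' f =>
      h G' (Relation.ReflTransGen.tail f (Or.inr ⟨k, rfl⟩))
    have loc := h _ Relation.ReflTransGen.refl
    have key : ∀ i k, ¬ MismatchParity (L i).addStar (R k).addStar := fun i k m =>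
      (noBetween _ _ _).1 m (loc.1 _ ⟨i, rfl⟩) (loc.2 _ ⟨k, rfl⟩)
    have k1 : ∀ i k, Even (L i) → Odd (R k) → False := fun i k a b =>
      key i k (Or.inr ⟨(addStar_parity _).1 a, (addStar_parity _).2 b⟩)
    have k2 : ∀ i k, Odd (L i) → Even (R k) → False := fun i k a b =>
      key i k (Or.inl ⟨(addStar_parity _).2 a, (addStar_parity _).1 b⟩)
    obtain ⟨i0⟩ := id hι
    obtain ⟨k0⟩ := id hκ
    rcases pL i0 with e | e
    · have r : ∀ k, Even (R k) := fun k => (pR k).resolve_right fun b => k1 i0 k e b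
      refine Or.inr (Odd.mk trivial ?_)
      rintro G' (⟨i, rfl⟩ | ⟨k, rfl⟩)
      · exact (pL i).resolve_right fun b => k2 i k0 b (r k0)
      · exact r k
    · have r : ∀ k, Odd (R k) := fun k => (pR k).resolve_left fun b => k2 i0 k e b
      refine Or.inl (Even.mk ?_)
      rintro G' (⟨i, rfl⟩ | ⟨k, rfl⟩)
      · exact (pL i).resolve_left fun b => k1 i k0 b (r k0)
      · exact r k

end Game
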